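/- Let p be a symmetric probability density function on ℝ whose Fourier transform p̂ is continuously differentiable and satisfies p̂(t) = 0 for |t| > 1, and let G : ℝ → ℝ be an odd bounded-variation function whose Fourier–Stieltjes transform Ĝ(s) := ∫ e^{isx} dG(x) (which is even, since G is odd) vanishes for |s| > γ, for some γ > 0. Then for all real u, the Fourier transform of the product p·G satisfies: (pG)^(u) = (i/(2π)) · p.v.∫_{-∞}^{∞} p̂(u-s)·Ĝ(s) ds/s = (i/(2π)) · ∫_{-∞}^{∞} [(p̂(u-s) - p̂(u))/s]·Ĝ(s) ds, where the last integral converges in the Lebesgue sense. -/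

import Mathlib

open MeasureTheory Filter Set
open scoped Real Topology

/-- The integrand `e^{-itx} f(t) / t` of the integral defining `𝔊(f)(x)`. -/
noncomputable def pvI (f : ℝ → ℂ) (x t : ℝ) : ℂ :=
  Complex.exp (-(Complex.I) * t * x) * f t / t

/-- `HasG f x L` means that the principal-value integral defining
`𝔊(f)(x) = (i/(2π)) p.v.∫_{-∞}^∞ e^{-itx} f(t) dt/t` exists and equals `L`, where
`p.v.∫ = lim_{ε↓0, A↑∞} (∫_{-A}^{-ε} + ∫_ε^A)`. -/
def HasG (f : ℝ → ℂ) (x : ℝ) (L : ℂ) : Prop :=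
  Tendsto (fun q : ℝ × ℝ =>
      (Complex.I / (2 * (Real.pi : ℂ))) *
        ((∫ t in (-q.2)..(-q.1), pvI f x t) + ∫ t in q.1..q.2, pvI f x t))
    ((𝓝[>] (0 : ℝ)) ×ˢ atTop) (𝓝 L)

/-- The operator `Λ`: `(Λh)(t) = -(h(0) - [h(t) + h'(t)(-t)])/t` for `t ≠ 0`, `(Λh)(0) = 0`. -/
noncomputable def Lam (h : ℝ → ℂ) (t : ℝ) : ℂ :=
  if t = 0 then 0 else -((h 0 - (h t + deriv h t * (-(t : ℂ)))) / (t : ℂ))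


lemma dir_inner (t a : ℝ) : ∫ s in (0:ℝ)..a, Real.exp (-s * t) * Real.sin s
    = (1 + t^2)⁻¹ - Real.exp (-a * t) * (Real.cos a + t * Real.sin a) * (1 + t^2)⁻¹ := by
  have h0 : (1 + t^2) ≠ 0 := by positivity
  have hd : ∀ s ∈ uIcc 0 a, HasDerivAt
      (fun s : ℝ => - (Real.exp (-s * t) * (Real.cos s + t * Real.sin s) * (1 + t^2)⁻¹))
      (Real.exp (-s * t) * Real.sin s) s := by
    intro s _
    have h1 : HasDerivAt (fun s : ℝ => Real.exp (-s * t)) (Real.exp (-s * t) * (-1 * t)) s :=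
      (((hasDerivAt_id s).neg).mul_const t).exp
    have h2 : HasDerivAt (fun s : ℝ => Real.cos s + t * Real.sin s)
        (-Real.sin s + t * Real.cos s) s :=
      (Real.hasDerivAt_cos s).add ((Real.hasDerivAt_sin s).const_mul t)
    refine ((h1.mul h2).mul_const ((1 + t^2)⁻¹)).neg.congr_deriv ?_
    field_simp
    ring
  rw [intervalIntegral.integral_eq_sub_of_hasDerivAt hd
    ((by fun_prop : Continuous fun s : ℝ => Real.exp (-s * t) * Real.sin s).intervalIntegrable _ _)]
  simp
  ring

lemma dir_exp {s : ℝ} (hs : 0 < s) : ∫ t in Ioi (0:ℝ), Real.exp (-s * t) = s⁻¹ := by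
  rw [integral_exp_mul_Ioi (by linarith) 0]
  simp

lemma dir_integrable {a : ℝ} (ha : 0 < a) : Integrable
    (Function.uncurry (fun s t : ℝ => Real.exp (-s * t) * Real.sin s))
    ((volume.restrict (uIoc 0 a)).prod (volume.restrict (Ioi 0))) := by
  rw [uIoc_of_le ha.le]
  have hm : Continuous (Function.uncurry (fun s t : ℝ => Real.exp (-s * t) * Real.sin s)) := by
    unfold Function.uncurry; fun_prop
  rw [integrable_prod_iff hm.aestronglyMeasurable]
  constructor
  · filter_upwards [ae_restrict_mem measurableSet_Ioc] with s hs
    exact (integrableOn_exp_mul_Ioi (by linarith [hs.1] : -s < 0) 0).mul_const (Real.sin s)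
  · have h1 : Integrable (fun s => |Real.sinc s|) (volume.restrict (Ioc 0 a)) :=
      (Real.continuous_sinc.abs.integrableOn_Icc (a := 0) (b := a)).mono_set Ioc_subset_Icc_self
    refine h1.congr ?_
    filter_upwards [ae_restrict_mem measurableSet_Ioc] with s hs
    simp only [Function.uncurry, norm_mul, Real.norm_eq_abs, Real.abs_exp]
    rw [integral_mul_const, dir_exp hs.1, Real.sinc_of_ne_zero hs.1.ne', abs_div, abs_of_pos hs.1]
    ring

noncomputable def DI (a : ℝ) : ℝ := ∫ s in (0:ℝ)..a, Real.sinc s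

lemma DI_eq {a : ℝ} (ha : 0 < a) : DI a = ∫ t in Ioi (0:ℝ), ((1 + t^2)⁻¹ -
    Real.exp (-a * t) * (Real.cos a + t * Real.sin a) * (1 + t^2)⁻¹) := by
  simp_rw [← dir_inner]
  rw [← intervalIntegral_integral_swap (dir_integrable ha), DI]
  refine intervalIntegral.integral_congr_ae ?_
  refine ae_of_all _ fun s hs => ?_
  rw [uIoc_of_le ha.le] at hs
  rw [integral_mul_const, dir_exp hs.1, Real.sinc_of_ne_zero hs.1.ne']
  ring

lemma DI_bound {a : ℝ} (ha : 0 < a) : |DI a - π / 2| ≤ 2 / a := by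
  have hb : ∀ t ∈ Ioi (0:ℝ), ‖Real.exp (-a * t) * (Real.cos a + t * Real.sin a) * (1 + t^2)⁻¹‖
      ≤ 2 * Real.exp (-a * t) := by
    intro t ht
    have ht : 0 < t := ht
    rw [norm_mul, norm_mul, Real.norm_eq_abs, Real.abs_exp, Real.norm_eq_abs, Real.norm_eq_abs,
      abs_of_pos (by positivity : 0 < (1 + t^2)⁻¹), mul_assoc, mul_comm 2]
    refine mul_le_mul_of_nonneg_left ?_ (Real.exp_pos _).le
    rw [← div_eq_mul_inv, div_le_iff₀ (by positivity)]
    have : |Real.cos a + t * Real.sin a| ≤ 1 + t := by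
      refine (abs_add_le _ _).trans ?_
      rw [abs_mul, abs_of_pos ht]
      nlinarith [Real.abs_cos_le_one a, Real.abs_sin_le_one a]
    nlinarith [sq_nonneg (t - 1)]
  have hE : IntegrableOn (fun t => 2 * Real.exp (-a * t)) (Ioi 0) :=
    (integrableOn_exp_mul_Ioi (by linarith : -a < 0) 0).const_mul _
  have hi : IntegrableOn (fun t => Real.exp (-a * t) * (Real.cos a + t * Real.sin a) * (1 + t^2)⁻¹)
      (Ioi 0) := by
    refine Integrable.mono' hE ?_ ((ae_restrict_iff' measurableSet_Ioi).2 (ae_of_all _ hb))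
    exact (by fun_prop : Measurable _).aestronglyMeasurable
  rw [DI_eq ha, integral_sub integrable_inv_one_add_sq.integrableOn hi, integral_Ioi_inv_one_add_sq]
  simp only [Real.arctan_zero, sub_zero, sub_sub_cancel_left, abs_neg]
  refine (norm_integral_le_of_norm_le hE ((ae_restrict_iff' measurableSet_Ioi).2
    (ae_of_all _ hb))).trans ?_
  rw [integral_const_mul, dir_exp ha, div_eq_mul_inv]

lemma DI_neg (a : ℝ) : DI (-a) = - DI a := by
  have := intervalIntegral.integral_comp_neg (a := 0) (b := a) Real.sinc
  simp only [Real.sinc_neg, neg_zero] at this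
  rw [DI, DI, this, intervalIntegral.integral_symm]

lemma DI_cont : Continuous DI :=
  intervalIntegral.continuous_primitive
    (fun a b => Real.continuous_sinc.intervalIntegrable a b) 0

lemma DI_zero : DI 0 = 0 := by simp [DI]

lemma DI_le_pos {a : ℝ} (ha : 0 < a) : |DI a| ≤ 4 := by
  rcases le_total a 1 with h | h
  · have := intervalIntegral.norm_integral_le_of_norm_le_const (a := 0) (b := a) (f := Real.sinc)
      (C := 1) (fun x _ => Real.abs_sinc_le_one x)
    rw [Real.norm_eq_abs, sub_zero, abs_of_pos ha] at this
    unfold DI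
    linarith
  · have h1 := abs_le.1 (DI_bound ha)
    have h2 : 2 / a ≤ 2 := by rw [div_le_iff₀ ha]; linarith
    rw [abs_le]
    constructor <;> linarith [Real.pi_pos, Real.pi_lt_four]

lemma DI_le (a : ℝ) : |DI a| ≤ 4 := by
  rcases lt_trichotomy a 0 with h | h | h
  · rw [← neg_neg a, DI_neg, abs_neg]; exact DI_le_pos (by linarith)
  · simp [h, DI_zero]
  · exact DI_le_pos h

lemma DI_atTop : Tendsto DI atTop (𝓝 (π / 2)) := by
  rw [tendsto_iff_norm_sub_tendsto_zero]
  refine squeeze_zero' (Eventually.of_forall fun _ => norm_nonneg _)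
    ((eventually_gt_atTop 0).mono fun a ha => DI_bound ha) ?_
  exact tendsto_const_nhds.div_atTop tendsto_id

lemma DI_atBot : Tendsto DI atBot (𝓝 (-(π / 2))) := by
  have := (DI_atTop.comp tendsto_neg_atBot_atTop).neg
  refine this.congr fun x => ?_
  simp [DI_neg]

/-- truncated kernel -/
noncomputable def KK (q : ℝ × ℝ) (v : ℝ) : ℝ := DI (q.2 * v) - DI (q.1 * v)

lemma KK_le (q : ℝ × ℝ) (v : ℝ) : |KK q v| ≤ 8 := by
  have h1 := abs_le.1 (DI_le (q.2 * v))
  have h2 := abs_le.1 (DI_le (q.1 * v))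
  rw [KK, abs_le]; constructor <;> linarith

lemma KK_cont (q : ℝ × ℝ) : Continuous (KK q) := by
  unfold KK
  exact (DI_cont.comp (by fun_prop)).sub (DI_cont.comp (by fun_prop))

lemma KK_tendsto (v : ℝ) : Tendsto (fun q => KK q v) ((𝓝[>] (0 : ℝ)) ×ˢ atTop)
    (𝓝 (π / 2 * SignType.sign v)) := by
  have h1 : Tendsto (fun q : ℝ × ℝ => DI (q.1 * v)) ((𝓝[>] (0 : ℝ)) ×ˢ atTop) (𝓝 0) := by
    have : Tendsto (fun e : ℝ => DI (e * v)) (𝓝[>] 0) (𝓝 0) := by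
      have h : Continuous fun e : ℝ => DI (e * v) := DI_cont.comp (by fun_prop)
      have := h.tendsto 0
      rw [zero_mul, DI_zero] at this
      exact this.mono_left nhdsWithin_le_nhds
    exact this.comp tendsto_fst
  have h2 : Tendsto (fun q : ℝ × ℝ => DI (q.2 * v)) ((𝓝[>] (0 : ℝ)) ×ˢ atTop)
      (𝓝 (π / 2 * SignType.sign v)) := by
    have : Tendsto (fun A : ℝ => DI (A * v)) atTop (𝓝 (π / 2 * SignType.sign v)) := by
      rcases lt_trichotomy v 0 with h | h | h
      · rw [sign_neg h]
        have := DI_atBot.comp (tendsto_id.atTop_mul_const_of_neg h)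
        simpa [Function.comp_def] using this
      · simp [h, DI_zero]
      · rw [sign_pos h]
        have := DI_atTop.comp (tendsto_id.atTop_mul_const h)
        simpa [Function.comp_def] using this
    exact this.comp tendsto_snd
  simpa [KK] using h2.sub h1

lemma KK_eq {e A : ℝ} (he : 0 < e) (hA : 0 < A) (v : ℝ) :
    ∫ t in e..A, Real.sin (t * v) / t = KK (e, A) v := by
  have h1 : ∫ t in e..A, Real.sin (t * v) / t = ∫ t in e..A, v * Real.sinc (t * v) := by
    refine intervalIntegral.integral_congr fun t ht => ?_
    have ht : 0 < t := lt_of_lt_of_le (lt_min he hA) ht.1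
    rcases eq_or_ne v 0 with h | h
    · simp [h]
    · rw [Real.sinc_of_ne_zero (mul_ne_zero ht.ne' h)]
      field_simp
  rw [h1, intervalIntegral.integral_const_mul, intervalIntegral.mul_integral_comp_mul_right, KK, DI, DI,
    intervalIntegral.integral_interval_sub_left] <;>
  exact Real.continuous_sinc.intervalIntegrable _ _

noncomputable def FT (ν : Measure ℝ) (s : ℝ) : ℂ := ∫ x : ℝ, Complex.exp (Complex.I * s * x) ∂ν

lemma norm_cexp_I (s x : ℝ) : ‖Complex.exp (Complex.I * s * x)‖ = 1 := by
  have : Complex.I * s * x = ((s * x : ℝ) : ℂ) * Complex.I := by push_cast; ring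
  rw [this, Complex.norm_exp_ofReal_mul_I]

lemma norm_cexp_negI (s x : ℝ) : ‖Complex.exp (-Complex.I * s * x)‖ = 1 := by
  have : -Complex.I * s * x = ((-(s * x) : ℝ) : ℂ) * Complex.I := by push_cast; ring
  rw [this, Complex.norm_exp_ofReal_mul_I]

lemma integrable_cexp (ν : Measure ℝ) [IsFiniteMeasure ν] (s : ℝ) :
    Integrable (fun x : ℝ => Complex.exp (Complex.I * s * x)) ν := by
  refine Integrable.mono' (integrable_const (1:ℝ)) ?_ (ae_of_all _ fun x => (norm_cexp_I s x).le)
  exact (by fun_prop : Continuous fun x : ℝ => Complex.exp (Complex.I * s * x)).aestronglyMeasurable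

lemma FT_cont (ν : Measure ℝ) [IsFiniteMeasure ν] : Continuous (FT ν) := by
  unfold FT
  refine continuous_of_dominated (bound := fun _ => 1) (fun s => (integrable_cexp ν s).1)
    (fun s => ae_of_all _ fun x => (norm_cexp_I s x).le) (integrable_const _)
    (ae_of_all _ fun x => by fun_prop)

lemma FT_le (ν : Measure ℝ) [IsFiniteMeasure ν] (s : ℝ) : ‖FT ν s‖ ≤ ν.real univ := by
  have := norm_integral_le_of_norm_le_const (μ := ν) (ae_of_all _ fun x => (norm_cexp_I s x).le)
  simpa [FT] using this

noncomputable def trunc (f : ℝ → ℂ) (x : ℝ) (q : ℝ × ℝ) : ℂ :=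
  (∫ t in (-q.2)..(-q.1), pvI f x t) + ∫ t in q.1..q.2, pvI f x t

lemma pvI_ii {f : ℝ → ℂ} (hf : Continuous f) (x : ℝ) {a b : ℝ} (h : (0:ℝ) ∉ uIcc a b) :
    IntervalIntegrable (pvI f x) volume a b := by
  apply ContinuousOn.intervalIntegrable
  unfold pvI
  refine ContinuousOn.div (by fun_prop) (by fun_prop) fun t ht => ?_
  intro h0
  rw [Complex.ofReal_eq_zero] at h0
  exact h (h0 ▸ ht)

lemma nmem1 {e A : ℝ} (he : 0 < e) (hA : 0 < A) : (0:ℝ) ∉ uIcc e A := fun h =>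
  absurd h.1 (not_le.2 (lt_min he hA))

lemma nmem2 {e A : ℝ} (he : 0 < e) (hA : 0 < A) : (0:ℝ) ∉ uIcc (-A) (-e) := fun h =>
  absurd h.2 (not_le.2 (max_lt (by linarith) (by linarith)))

lemma trunc_eq {f : ℝ → ℂ} (hf : Continuous f) (x : ℝ) {e A : ℝ} (he : 0 < e) (hA : 0 < A) :
    trunc f x (e, A) = ∫ t in e..A, (pvI f x (-t) + pvI f x t) := by
  have h2 : IntervalIntegrable (fun t => pvI f x (-t)) volume e A := by
    have h3 : (fun t => pvI f x (-t)) = fun t => -pvI (fun s => f (-s)) (-x) t := by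
      funext t
      simp only [pvI]
      push_cast
      rw [show -Complex.I * -(t:ℂ) * x = -Complex.I * t * -(x:ℂ) by ring]
      ring
    rw [h3]
    exact (pvI_ii (f := fun s => f (-s)) (by fun_prop) (-x) (nmem1 he hA)).neg
  rw [intervalIntegral.integral_add h2 (pvI_ii hf x (nmem1 he hA)), trunc,
    intervalIntegral.integral_comp_neg (pvI f x)]

lemma trunc_sub {f g : ℝ → ℂ} (hf : Continuous f) (hg : Continuous g) (x : ℝ) {e A : ℝ}
    (he : 0 < e) (hA : 0 < A) :
    trunc (fun s => f s - g s) x (e, A) = trunc f x (e, A) - trunc g x (e, A) := by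
  have : pvI (fun s => f s - g s) x = fun t => pvI f x t - pvI g x t := by
    funext t; simp only [pvI]; ring
  simp only [trunc, this]
  rw [intervalIntegral.integral_sub (pvI_ii hf x (nmem2 he hA)) (pvI_ii hg x (nmem2 he hA)),
    intervalIntegral.integral_sub (pvI_ii hf x (nmem1 he hA)) (pvI_ii hg x (nmem1 he hA))]
  ring

lemma pvI_pair (ν : Measure ℝ) [IsFiniteMeasure ν] (x t : ℝ) :
    pvI (FT ν) x (-t) + pvI (FT ν) x t =
      ∫ y, 2 * Complex.I * ((Real.sin (t * (y - x)) / t : ℝ) : ℂ) ∂ν := by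
  have e1 : pvI (FT ν) x t =
      ∫ y, Complex.exp (-Complex.I * t * x) / t * Complex.exp (Complex.I * t * y) ∂ν := by
    rw [integral_const_mul, pvI, FT]; ring
  have e2 : pvI (FT ν) x (-t) =
      ∫ y, Complex.exp (Complex.I * t * x) / (-t) * Complex.exp (Complex.I * (-t : ℝ) * y) ∂ν := by
    rw [integral_const_mul, pvI, FT]; push_cast; ring_nf
  rw [e1, e2, ← integral_add ((integrable_cexp ν _).const_mul _) ((integrable_cexp ν _).const_mul _)]
  congr 1
  funext y
  have h : ((Real.sin (t * (y - x)) / t : ℝ) : ℂ) = Complex.sin (t * (y - x)) / t := by push_cast; rfl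
  rw [h, Complex.sin]
  have a1 : Complex.exp (Complex.I * t * x) / (-t) * Complex.exp (Complex.I * (-t : ℝ) * y)
      = - (Complex.exp (-(t * (y - x)) * Complex.I) / t) := by
    have : (-(t * (y - x)) * Complex.I : ℂ) = Complex.I * t * x + Complex.I * (-t : ℝ) * y := by
      push_cast; ring
    rw [this, Complex.exp_add]; ring
  have a2 : Complex.exp (-Complex.I * t * x) / t * Complex.exp (Complex.I * t * y)
      = Complex.exp (t * (y - x) * Complex.I) / t := by
    have : (t * (y - x) * Complex.I : ℂ) = -Complex.I * t * x + Complex.I * t * y := by ring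
    rw [this, Complex.exp_add]; ring
  rw [a1, a2]
  linear_combination ((Complex.exp (-(t * (y - x)) * Complex.I) - Complex.exp (t * (y - x) * Complex.I)) / t) * (-Complex.I_sq)

lemma trunc_FT (ν : Measure ℝ) [IsFiniteMeasure ν] (x : ℝ) {e A : ℝ} (he : 0 < e) (hA : 0 < A) :
    trunc (FT ν) x (e, A) = ∫ y, 2 * Complex.I * ((KK (e, A) (y - x) : ℝ) : ℂ) ∂ν := by
  rw [trunc_eq (FT_cont ν) x he hA]
  simp_rw [pvI_pair]
  rw [intervalIntegral_integral_swap]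
  · congr 1
    funext y
    rw [intervalIntegral.integral_const_mul, intervalIntegral.integral_ofReal, KK_eq he hA]
  · have : IsFiniteMeasure (volume.restrict (uIoc e A)) := by unfold uIoc; infer_instance
    refine Integrable.mono' (integrable_const (2 * (min e A)⁻¹)) ?_ ?_
    · refine Measurable.aestronglyMeasurable ?_
      unfold Function.uncurry
      fun_prop
    · have : ∀ᵐ p ∂((volume.restrict (uIoc e A)).prod ν), p.1 ∈ uIoc e A :=
        Measure.quasiMeasurePreserving_fst.ae (ae_restrict_mem measurableSet_uIoc)
      filter_upwards [this] with p hp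
      have hp0 : min e A < p.1 := hp.1
      have hm : 0 < min e A := lt_min he hA
      simp only [Function.uncurry, norm_mul, Complex.norm_I, Complex.norm_real, norm_div,
        Real.norm_eq_abs, abs_of_pos (hm.trans hp0), Complex.norm_ofNat, mul_one]
      gcongr
      rw [inv_eq_one_div]
      gcongr
      exact Real.abs_sin_le_one _

lemma trunc_FT_le (ν : Measure ℝ) [IsFiniteMeasure ν] (x : ℝ) {e A : ℝ} (he : 0 < e) (hA : 0 < A) :
    ‖trunc (FT ν) x (e, A)‖ ≤ 16 * ν.real univ := by
  rw [trunc_FT ν x he hA]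
  refine norm_integral_le_of_norm_le_const (ae_of_all _ fun y => ?_)
  rw [norm_mul, norm_mul, Complex.norm_I, Complex.norm_real, Real.norm_eq_abs, Complex.norm_ofNat]
  linarith [KK_le (e, A) (y - x)]

lemma ev_pos : ∀ᶠ q : ℝ × ℝ in (𝓝[>] (0 : ℝ)) ×ˢ atTop, 0 < q.1 ∧ 0 < q.2 :=
  (eventually_mem_nhdsWithin (s := Ioi (0:ℝ))).prod_mk (eventually_gt_atTop 0)

lemma trunc_FT_tendsto (ν : Measure ℝ) [IsFiniteMeasure ν] (x : ℝ) :
    Tendsto (trunc (FT ν) x) ((𝓝[>] (0 : ℝ)) ×ˢ atTop)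
      (𝓝 (Complex.I * π * ((ν.real (Ioi x) - ν.real (Iio x) : ℝ) : ℂ))) := by
  have key : Tendsto (fun q => ∫ y, 2 * Complex.I * ((KK q (y - x) : ℝ) : ℂ) ∂ν)
      ((𝓝[>] (0 : ℝ)) ×ˢ atTop)
      (𝓝 (∫ y, 2 * Complex.I * ((π / 2 * SignType.sign (y - x) : ℝ) : ℂ) ∂ν)) := by
    refine tendsto_integral_filter_of_dominated_convergence (fun _ => 16) ?_ ?_ (integrable_const _) ?_
    · refine Eventually.of_forall fun q => Continuous.aestronglyMeasurable ?_
      have := KK_cont q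
      fun_prop
    · refine Eventually.of_forall fun q => ae_of_all _ fun y => ?_
      rw [norm_mul, norm_mul, Complex.norm_I, Complex.norm_real, Real.norm_eq_abs,
        Complex.norm_ofNat]
      linarith [KK_le q (y - x)]
    · refine ae_of_all _ fun y => ?_
      exact ((Complex.continuous_ofReal.tendsto _).comp (KK_tendsto (y - x))).const_mul _
  have hs : ∫ y, 2 * Complex.I * ((π / 2 * SignType.sign (y - x) : ℝ) : ℂ) ∂ν
      = Complex.I * π * ((ν.real (Ioi x) - ν.real (Iio x) : ℝ) : ℂ) := by
    have h1 : ∀ y : ℝ, (SignType.sign (y - x) : ℝ)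
        = (Ioi x).indicator (fun _ => (1:ℝ)) y - (Iio x).indicator (fun _ => (1:ℝ)) y := by
      intro y
      rcases lt_trichotomy y x with h | h | h
      · rw [sign_neg (by linarith)]; simp [h, h.le]
      · simp [h]
      · rw [sign_pos (by linarith)]; simp [h, h.le]
    rw [integral_const_mul, integral_complex_ofReal, integral_const_mul]
    simp_rw [h1]
    rw [integral_sub ((integrable_const _).indicator measurableSet_Ioi)
      ((integrable_const _).indicator measurableSet_Iio), integral_indicator_const _ measurableSet_Ioi,
      integral_indicator_const _ measurableSet_Iio]
    push_cast
    simp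
    ring
  rw [hs] at key
  refine key.congr' ?_
  filter_upwards [ev_pos] with q hq
  exact (trunc_FT ν x hq.1 hq.2).symm

lemma tendsto_Ioc_Ioi (ν : Measure ℝ) [IsFiniteMeasure ν] (x : ℝ) :
    Tendsto (fun n : ℕ => ν.real (Ioc x (x + n))) atTop (𝓝 (ν.real (Ioi x))) := by
  have hU : (⋃ n : ℕ, Ioc x (x + n)) = Ioi x := by
    ext y
    simp only [mem_iUnion, mem_Ioc, mem_Ioi]
    refine ⟨fun ⟨_, h⟩ => h.1, fun h => ?_⟩
    obtain ⟨n, hn⟩ := exists_nat_ge (y - x)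
    exact ⟨n, h, by linarith⟩
  have hm : Monotone (fun n : ℕ => Ioc x (x + n)) := fun a b hab =>
    Ioc_subset_Ioc_right (by have : (a:ℝ) ≤ b := by exact_mod_cast hab
                             linarith)
  have := tendsto_measure_iUnion_atTop (μ := ν) hm
  rw [hU] at this
  exact (ENNReal.tendsto_toReal (measure_ne_top _ _)).comp this

lemma tendsto_Ioc_Iio (ν : Measure ℝ) [IsFiniteMeasure ν] (x : ℝ) :
    Tendsto (fun n : ℕ => ν.real (Ioc (-x - n - 1) (x - 1 / ((n : ℝ) + 1)))) atTop
      (𝓝 (ν.real (Iio x))) := by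
  have hU : (⋃ n : ℕ, Ioc (-x - n - 1) (x - 1 / ((n : ℝ) + 1))) = Iio x := by
    ext y
    simp only [mem_iUnion, mem_Ioc, mem_Iio]
    constructor
    · rintro ⟨n, h⟩
      have : 0 < 1 / ((n : ℝ) + 1) := by positivity
      linarith
    · intro h
      obtain ⟨n, hn⟩ := exists_nat_ge (-x - y)
      obtain ⟨m, hm⟩ := exists_nat_one_div_lt (sub_pos.2 h)
      refine ⟨max n m, ?_, ?_⟩
      · have : (n : ℝ) ≤ (max n m : ℕ) := by exact_mod_cast le_max_left _ _
        linarith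
      · have : (m : ℝ) ≤ (max n m : ℕ) := by exact_mod_cast le_max_right _ _
        have := one_div_le_one_div_of_le (by positivity : (0:ℝ) < m + 1)
          (by linarith : (m : ℝ) + 1 ≤ (max n m : ℕ) + 1)
        linarith
  have hm : Monotone (fun n : ℕ => Ioc (-x - n - 1) (x - 1 / ((n : ℝ) + 1))) := fun a b hab => by
    have : (a:ℝ) ≤ b := by exact_mod_cast hab
    have := one_div_le_one_div_of_le (by positivity : (0:ℝ) < a + 1)
          (by linarith : (a : ℝ) + 1 ≤ b + 1)
    exact Ioc_subset_Ioc (by linarith) (by linarith)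
  have := tendsto_measure_iUnion_atTop (μ := ν) hm
  rw [hU] at this
  exact (ENNReal.tendsto_toReal (measure_ne_top _ _)).comp this

lemma tendsto_Ioc_empty (ν : Measure ℝ) [IsFiniteMeasure ν] (x : ℝ) :
    Tendsto (fun n : ℕ => ν.real (Ioc x (x + 1 / ((n : ℝ) + 1)))) atTop (𝓝 0) := by
  have hU : (⋂ n : ℕ, Ioc x (x + 1 / ((n : ℝ) + 1))) = ∅ := by
    ext y
    simp only [mem_iInter, mem_Ioc, mem_empty_iff_false, iff_false, not_forall]
    by_contra! h
    obtain ⟨m, hm⟩ := exists_nat_one_div_lt (sub_pos.2 (h 0).1)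
    linarith [(h m).2]
  have hm : Antitone (fun n : ℕ => Ioc x (x + 1 / ((n : ℝ) + 1))) := fun a b hab => by
    have : (a:ℝ) ≤ b := by exact_mod_cast hab
    have := one_div_le_one_div_of_le (by positivity : (0:ℝ) < a + 1)
          (by linarith : (a : ℝ) + 1 ≤ b + 1)
    exact Ioc_subset_Ioc_right (by linarith)
  have := tendsto_measure_iInter_atTop (μ := ν) (fun n => measurableSet_Ioc.nullMeasurableSet) hm
    ⟨0, measure_ne_top _ _⟩
  rw [hU, measure_empty] at this
  exact (ENNReal.tendsto_toReal (by simp)).comp this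

lemma G_formula (G : ℝ → ℝ) (hGodd : ∀ x : ℝ, G (-x) = -G x)
    (ν₁ ν₂ : Measure ℝ) [IsFiniteMeasure ν₁] [IsFiniteMeasure ν₂]
    (hGst : ∀ x y : ℝ, y ≤ x →
      G x - G y = (ν₁ (Set.Ioc y x)).toReal - (ν₂ (Set.Ioc y x)).toReal) (x : ℝ) :
    (ν₁.real (Ioi x) - ν₁.real (Iio x)) - (ν₂.real (Ioi x) - ν₂.real (Iio x)) = -2 * G x := by
  have hst : ∀ y x : ℝ, y ≤ x → ν₁.real (Ioc y x) - ν₂.real (Ioc y x) = G x - G y :=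
    fun y x h => (hGst x y h).symm
  have t1 := ((tendsto_Ioc_Ioi ν₁ x).comp (tendsto_add_atTop_nat 1)).sub
    ((tendsto_Ioc_Ioi ν₂ x).comp (tendsto_add_atTop_nat 1))
  have t2 := (tendsto_Ioc_Iio ν₁ x).sub (tendsto_Ioc_Iio ν₂ x)
  have t3 := (tendsto_Ioc_empty ν₁ (-x)).sub (tendsto_Ioc_empty ν₂ (-x))
  have t4 := (t1.sub t2).sub t3
  have : ∀ᶠ n : ℕ in atTop, -2 * G x = (ν₁.real (Ioc x (x + (n + 1 : ℕ))) - ν₂.real (Ioc x (x + (n + 1 : ℕ))))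
      - (ν₁.real (Ioc (-x - n - 1) (x - 1 / ((n : ℝ) + 1)))
        - ν₂.real (Ioc (-x - n - 1) (x - 1 / ((n : ℝ) + 1))))
      - (ν₁.real (Ioc (-x) (-x + 1 / ((n : ℝ) + 1))) - ν₂.real (Ioc (-x) (-x + 1 / ((n : ℝ) + 1)))) := by
    obtain ⟨N, hN⟩ := exists_nat_ge (-2 * x + 1)
    filter_upwards [eventually_ge_atTop N] with n hn
    have hn' : (N : ℝ) ≤ n := by exact_mod_cast hn
    have h1 : 0 < 1 / ((n : ℝ) + 1) := by positivity
    have h2 : 1 / ((n : ℝ) + 1) ≤ 1 := by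
      rw [div_le_one (by positivity)]; linarith [Nat.cast_nonneg (α := ℝ) n]
    rw [hst _ _ (by push_cast; linarith [Nat.cast_nonneg (α := ℝ) n]), hst _ _ (by linarith), hst _ _ (by linarith)]
    have a1 : -x - n - 1 = -(x + (n + 1 : ℕ)) := by push_cast; ring
    have a2 : -x + 1 / ((n : ℝ) + 1) = -(x - 1 / ((n : ℝ) + 1)) := by ring
    rw [a1, a2, hGodd, hGodd, hGodd]
    ring
  have t5 := t4.congr' (this.mono fun n hn => hn.symm)
  have := tendsto_nhds_unique t5 tendsto_const_nhds
  linarith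

lemma prod_int {p : ℝ → ℝ} (hpmeas : Measurable p) (hpint : Integrable p (volume : Measure ℝ))
    {g : ℝ → ℂ} (hg : Continuous g) (u : ℝ) {a b : ℝ} (h0 : (0:ℝ) ∉ uIcc a b) :
    Integrable (Function.uncurry fun t x : ℝ => Complex.exp (Complex.I * u * x) * p x * pvI g x t)
      ((volume.restrict (uIoc a b)).prod volume) := by
  have hfin : IsFiniteMeasure (volume.restrict (uIoc a b)) := by unfold uIoc; infer_instance
  obtain ⟨C, hC⟩ := (isCompact_uIcc (a := a) (b := b)).exists_bound_of_continuousOn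
    (f := fun t : ℝ => g t / t) (by
      refine ContinuousOn.div (by fun_prop) (by fun_prop) fun t ht => ?_
      intro h
      rw [Complex.ofReal_eq_zero] at h
      exact h0 (h ▸ ht))
  have hd : Integrable (fun z : ℝ × ℝ => C * ‖p z.2‖)
      ((volume.restrict (uIoc a b)).prod volume) :=
    (hpint.norm.comp_snd _).const_mul C
  refine hd.mono' ?_ ?_
  · refine Measurable.aestronglyMeasurable ?_
    unfold Function.uncurry pvI
    have := hg.measurable
    fun_prop
  · have : ∀ᵐ z ∂((volume.restrict (uIoc a b)).prod (volume : Measure ℝ)), z.1 ∈ uIoc a b :=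
      Measure.quasiMeasurePreserving_fst.ae (ae_restrict_mem measurableSet_uIoc)
    filter_upwards [this] with z hz
    have := hC z.1 (uIoc_subset_uIcc hz)
    simp only [Function.uncurry, pvI]
    rw [norm_mul, norm_mul, norm_cexp_I, mul_div_assoc, norm_mul, norm_cexp_negI, one_mul, one_mul,
      Complex.norm_real, mul_comm]
    exact mul_le_mul_of_nonneg_right this (norm_nonneg _)

lemma part_eq {p : ℝ → ℝ} (hpmeas : Measurable p) (hpint : Integrable p (volume : Measure ℝ))
    (phat : ℝ → ℂ) (hphat : ∀ t : ℝ, phat t = ∫ x : ℝ, Complex.exp (Complex.I * t * x) * p x)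
    {g : ℝ → ℂ} (hg : Continuous g) (u : ℝ) {a b : ℝ} (h0 : (0:ℝ) ∉ uIcc a b) :
    Integrable (fun x : ℝ => Complex.exp (Complex.I * u * x) * p x * ∫ t in a..b, pvI g x t) ∧
    ∫ t in a..b, pvI (fun s => phat (u - s) * g s) 0 t =
      ∫ x : ℝ, Complex.exp (Complex.I * u * x) * p x * ∫ t in a..b, pvI g x t := by
  have hi := prod_int hpmeas hpint hg u h0
  constructor
  · simp_rw [← intervalIntegral.integral_const_mul, intervalIntegral.intervalIntegral_eq_integral_uIoc]
    exact hi.integral_prod_right.smul (if a ≤ b then (1:ℝ) else -1)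
  · simp_rw [← intervalIntegral.integral_const_mul]
    rw [← intervalIntegral_integral_swap hi]
    congr 1
    funext t
    simp only [pvI]
    rw [hphat]
    simp only [Complex.ofReal_zero, mul_zero, Complex.exp_zero, one_mul]
    rw [mul_div_assoc, ← integral_mul_const]
    congr 1
    funext x
    have : (Complex.I * ((u - t : ℝ) : ℂ) * x) = Complex.I * u * x + -Complex.I * t * x := by
      push_cast; ring
    rw [this, Complex.exp_add]
    ring

lemma trunc_prod {p : ℝ → ℝ} (hpmeas : Measurable p) (hpint : Integrable p (volume : Measure ℝ))
    (phat : ℝ → ℂ) (hphat : ∀ t : ℝ, phat t = ∫ x : ℝ, Complex.exp (Complex.I * t * x) * p x)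
    {g : ℝ → ℂ} (hg : Continuous g) (u : ℝ) {e A : ℝ} (he : 0 < e) (hA : 0 < A) :
    Integrable (fun x : ℝ => Complex.exp (Complex.I * u * x) * p x * trunc g x (e, A)) ∧
    trunc (fun s => phat (u - s) * g s) 0 (e, A) =
      ∫ x : ℝ, Complex.exp (Complex.I * u * x) * p x * trunc g x (e, A) := by
  obtain ⟨a1, a2⟩ := part_eq hpmeas hpint phat hphat hg u (nmem1 he hA)
  obtain ⟨b1, b2⟩ := part_eq hpmeas hpint phat hphat hg u (nmem2 he hA)
  simp only [trunc, mul_add]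
  refine ⟨b1.add a1, ?_⟩
  rw [integral_add b1 a1, a2, b2]

lemma trunc_lim {R : ℝ → ℂ} (hR : Integrable R) :
    Tendsto (fun q : ℝ × ℝ => (∫ t in (-q.2)..(-q.1), R t) + ∫ t in q.1..q.2, R t)
      ((𝓝[>] (0 : ℝ)) ×ˢ atTop) (𝓝 (∫ t, R t)) := by
  have h1 : Tendsto (fun q : ℝ × ℝ => ∫ t in (-q.2)..q.2, R t) ((𝓝[>] (0 : ℝ)) ×ˢ atTop)
      (𝓝 (∫ t, R t)) :=
    intervalIntegral_tendsto_integral hR (tendsto_neg_atTop_atBot.comp tendsto_snd) tendsto_snd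
  have ii : ∀ a b, IntervalIntegrable R volume a b := fun a b => hR.intervalIntegrable
  have h2 : Tendsto (fun q : ℝ × ℝ => (∫ t in 0..q.1, R t) - ∫ t in 0..(-q.1), R t)
      ((𝓝[>] (0 : ℝ)) ×ˢ atTop) (𝓝 0) := by
    have c := intervalIntegral.continuous_primitive ii 0
    have c2 : Continuous fun e : ℝ => (∫ t in 0..e, R t) - ∫ t in 0..(-e), R t :=
      c.sub (c.comp continuous_neg)
    have := c2.tendsto 0
    simp only [neg_zero, intervalIntegral.integral_same, sub_zero] at this
    exact (this.mono_left nhdsWithin_le_nhds).comp tendsto_fst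
  have h3 := h1.sub h2
  rw [sub_zero] at h3
  refine h3.congr fun q => ?_
  rw [intervalIntegral.integral_interval_sub_left (ii _ _) (ii _ _),
    ← intervalIntegral.integral_add_adjacent_intervals (ii (-q.2) (-q.1)) (ii (-q.1) q.2),
    ← intervalIntegral.integral_add_adjacent_intervals (ii (-q.1) (q.1)) (ii (q.1) q.2)]
  ring

/-- Convolution representation of the Fourier transform of `pG`: let `p` be a symmetric
probability density whose Fourier transform `p̂` is `C¹` and vanishes for `|t| > 1`; let `G` be an
odd function of bounded variation (encoded by two finite measures `ν₁, ν₂` via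
`G(x) - G(y) = ν₁((y,x]) - ν₂((y,x])` for `y ≤ x`), whose Fourier--Stieltjes transform
`Ĝ(s) = ∫ e^{isx} dν₁ - ∫ e^{isx} dν₂` (an even function) vanishes for `|s| > γ`, `γ > 0`. Then
for all real `u`,
`(pG)^(u) = (i/(2π)) p.v.∫ p̂(u-s) Ĝ(s) ds/s = (i/(2π)) ∫ [(p̂(u-s) - p̂(u))/s] Ĝ(s) ds`,
where the last integral converges in the Lebesgue sense. -/
theorem stmt15 (p : ℝ → ℝ) (hpmeas : Measurable p) (hppos : ∀ x : ℝ, 0 ≤ p x)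
    (hpint : Integrable p (volume : Measure ℝ)) (hpone : (∫ x : ℝ, p x) = 1)
    (hpeven : ∀ x : ℝ, p (-x) = p x)
    (phat : ℝ → ℂ) (hphat : ∀ t : ℝ, phat t = ∫ x : ℝ, Complex.exp (Complex.I * t * x) * p x)
    (hphatC1 : ContDiff ℝ 1 phat)
    (hphat0 : ∀ t : ℝ, 1 < |t| → phat t = 0)
    (G : ℝ → ℝ) (hGodd : ∀ x : ℝ, G (-x) = -G x)
    (ν₁ ν₂ : Measure ℝ) (hν₁ : IsFiniteMeasure ν₁) (hν₂ : IsFiniteMeasure ν₂)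
    (hGst : ∀ x y : ℝ, y ≤ x →
      G x - G y = (ν₁ (Set.Ioc y x)).toReal - (ν₂ (Set.Ioc y x)).toReal)
    (Ghat : ℝ → ℂ)
    (hGhat : ∀ s : ℝ, Ghat s
      = (∫ x : ℝ, Complex.exp (Complex.I * s * x) ∂ν₁)
        - ∫ x : ℝ, Complex.exp (Complex.I * s * x) ∂ν₂)
    (γ : ℝ) (hγ : 0 < γ)
    (hGhat0 : ∀ s : ℝ, γ < |s| → Ghat s = 0) :
    ∀ u : ℝ,
      HasG (fun s : ℝ => phat (u - s) * Ghat s) 0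
        (∫ x : ℝ, Complex.exp (Complex.I * u * x) * (p x * G x)) ∧
      Integrable (fun s : ℝ => (phat (u - s) - phat u) / (s : ℂ) * Ghat s) (volume : Measure ℝ) ∧
      (∫ x : ℝ, Complex.exp (Complex.I * u * x) * (p x * G x))
        = (Complex.I / (2 * (Real.pi : ℂ)))
            * ∫ s : ℝ, (phat (u - s) - phat u) / (s : ℂ) * Ghat s := by
  intro u
  have hGeq : Ghat = fun s => FT ν₁ s - FT ν₂ s := funext hGhat
  have hGc : Continuous Ghat := by
    rw [hGeq]; exact (FT_cont ν₁).sub (FT_cont ν₂)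
  set M : ℝ := 16 * ν₁.real univ + 16 * ν₂.real univ with hM
  have hpi : (π : ℂ) ≠ 0 := by exact_mod_cast Real.pi_ne_zero
  have htr : ∀ (x : ℝ) {e A : ℝ}, 0 < e → 0 < A → trunc Ghat x (e, A)
      = trunc (FT ν₁) x (e, A) - trunc (FT ν₂) x (e, A) := fun x e A he hA => by
    rw [hGeq]; exact trunc_sub (FT_cont ν₁) (FT_cont ν₂) x he hA
  have hbd : ∀ (x : ℝ) {e A : ℝ}, 0 < e → 0 < A → ‖trunc Ghat x (e, A)‖ ≤ M :=
    fun x e A he hA => by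
      rw [htr x he hA]
      exact (norm_sub_le _ _).trans
        (add_le_add (trunc_FT_le ν₁ x he hA) (trunc_FT_le ν₂ x he hA))
  have hlim : ∀ x : ℝ, Tendsto (trunc Ghat x) ((𝓝[>] (0 : ℝ)) ×ˢ atTop)
      (𝓝 (-(2 * Complex.I * π) * G x)) := fun x => by
    have h := (trunc_FT_tendsto ν₁ x).sub (trunc_FT_tendsto ν₂ x)
    rw [← mul_sub, ← Complex.ofReal_sub, G_formula G hGodd ν₁ ν₂ hGst x] at h
    have e1 : Complex.I * π * ((-2 * G x : ℝ) : ℂ) = -(2 * Complex.I * π) * G x := by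
      push_cast; ring
    rw [e1] at h
    refine h.congr' ?_
    filter_upwards [ev_pos] with q hq
    exact (htr x hq.1 hq.2).symm
  -- first limit
  have hmain : Tendsto (trunc (fun s => phat (u - s) * Ghat s) 0) ((𝓝[>] (0 : ℝ)) ×ˢ atTop)
      (𝓝 (∫ x : ℝ, Complex.exp (Complex.I * u * x) * p x * (-(2 * Complex.I * π) * G x))) := by
    have key : Tendsto (fun q : ℝ × ℝ =>
        ∫ x : ℝ, Complex.exp (Complex.I * u * x) * p x * trunc Ghat x q)
        ((𝓝[>] (0 : ℝ)) ×ˢ atTop)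
        (𝓝 (∫ x : ℝ, Complex.exp (Complex.I * u * x) * p x * (-(2 * Complex.I * π) * G x))) := by
      refine tendsto_integral_filter_of_dominated_convergence (fun x => ‖p x‖ * M) ?_ ?_
        (hpint.norm.mul_const M) ?_
      · filter_upwards [ev_pos] with q hq
        exact (trunc_prod hpmeas hpint phat hphat hGc u hq.1 hq.2).1.1
      · filter_upwards [ev_pos] with q hq
        refine ae_of_all _ fun x => ?_
        rw [norm_mul, norm_mul, norm_cexp_I, one_mul, Complex.norm_real]
        exact mul_le_mul_of_nonneg_left (hbd x hq.1 hq.2) (norm_nonneg _)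
      · exact ae_of_all _ fun x => (hlim x).const_mul _
    refine key.congr' ?_
    filter_upwards [ev_pos] with q hq
    exact (trunc_prod hpmeas hpint phat hphat hGc u hq.1 hq.2).2.symm
  have hL : (Complex.I / (2 * (π : ℂ))) *
      (∫ x : ℝ, Complex.exp (Complex.I * u * x) * p x * (-(2 * Complex.I * π) * G x))
      = ∫ x : ℝ, Complex.exp (Complex.I * u * x) * (p x * G x) := by
    rw [← integral_const_mul]
    congr 1
    funext x
    field_simp
    linear_combination (-((p x : ℂ) * G x)) * Complex.I_sq
  -- integrability
  have hphc : Continuous phat := hphatC1.continuous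
  have hcs : HasCompactSupport phat := by
    refine HasCompactSupport.intro (isCompact_Icc (a := (-1:ℝ)) (b := 1)) fun t ht => ?_
    refine hphat0 t ?_
    by_contra h
    exact ht (abs_le.1 (not_lt.1 h))
  obtain ⟨C, hC⟩ := hphatC1.lipschitzWith_of_hasCompactSupport hcs (by simp)
  have hR : Integrable (fun s : ℝ => (phat (u - s) - phat u) / (s : ℂ) * Ghat s)
      (volume : Measure ℝ) := by
    have hdom : Integrable ((Icc (-γ) γ).indicator fun _ : ℝ => (C : ℝ) *
        (ν₁.real univ + ν₂.real univ)) (volume : Measure ℝ) := by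
      rw [integrable_indicator_iff measurableSet_Icc]
      exact integrableOn_const (by simp)
    refine hdom.mono' ?_ (ae_of_all _ fun s => ?_)
    · refine Measurable.aestronglyMeasurable ?_
      have h1 := hphc.measurable
      have h2 := hGc.measurable
      fun_prop
    · by_cases hs : s ∈ Icc (-γ) γ
      · rw [indicator_of_mem hs, norm_mul]
        have h1 : ‖(phat (u - s) - phat u) / (s : ℂ)‖ ≤ C := by
          rw [norm_div, Complex.norm_real]
          refine div_le_of_le_mul₀ (norm_nonneg _) C.2 ?_
          have := hC.dist_le_mul (u - s) u
          rw [dist_eq_norm, dist_eq_norm] at this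
          simpa using this
        have h2 : ‖Ghat s‖ ≤ ν₁.real univ + ν₂.real univ := by
          rw [hGeq]
          exact (norm_sub_le _ _).trans (add_le_add (FT_le ν₁ s) (FT_le ν₂ s))
        exact mul_le_mul h1 h2 (norm_nonneg _) C.2
      · have : Ghat s = 0 := hGhat0 s (by
          by_contra h
          exact hs (abs_le.1 (not_lt.1 h)))
        rw [indicator_of_notMem hs, this]
        simp
  -- second expression
  have hG0 : G 0 = 0 := by
    have := hGodd 0
    rw [neg_zero] at this
    linarith
  have hR2 : Tendsto (trunc (fun s => phat (u - s) * Ghat s) 0) ((𝓝[>] (0 : ℝ)) ×ˢ atTop)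
      (𝓝 (∫ s : ℝ, (phat (u - s) - phat u) / (s : ℂ) * Ghat s)) := by
    have h := (trunc_lim hR).add ((hlim 0).const_mul (phat u))
    rw [hG0, Complex.ofReal_zero, mul_zero, mul_zero, add_zero] at h
    refine h.congr' ?_
    filter_upwards [ev_pos] with q hq
    have hpt : pvI (fun s => phat (u - s) * Ghat s) 0 = fun t : ℝ =>
        (phat (u - t) - phat u) / (t : ℂ) * Ghat t + phat u * pvI Ghat 0 t := by
      funext t
      simp only [pvI, Complex.ofReal_zero, mul_zero, Complex.exp_zero, one_mul]
      ring
    have i1 := pvI_ii hGc 0 (nmem1 hq.1 hq.2)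
    have i2 := pvI_ii hGc 0 (nmem2 hq.1 hq.2)
    simp only [trunc, hpt]
    rw [intervalIntegral.integral_add hR.intervalIntegrable (i1.const_mul _),
      intervalIntegral.integral_add hR.intervalIntegrable (i2.const_mul _),
      intervalIntegral.integral_const_mul, intervalIntegral.integral_const_mul]
    ring
  have : NeBot ((𝓝[>] (0 : ℝ)) ×ˢ (atTop : Filter ℝ)) := inferInstance
  refine ⟨?_, hR, ?_⟩
  · rw [← hL]
    exact hmain.const_mul _
  · rw [← hL, tendsto_nhds_unique hmain hR2]
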